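/- Let X be the (1+N)×(1+N) complex matrix with block form X = [[-ih, -iV - M], [-iV† - M†, -Z]] where h ∈ ℝ, V, M are 1×N complex row vectors, and Z = diag(γ_k + iE_k) with γ_k > 0. If ‖M‖ < (1/2)·min_k γ_k, then there exists m > 0 such that whenever ‖V‖ > m, every eigenvalue of X has strictly negative real part. -/

import Mathlib

open Matrix

open scoped ComplexConjugate

theorem norm_sum_mul_le_sqrt_mul_sqrt {ι : Type*} [Fintype ι] (a b : ι → ℂ) :
    ‖∑ k, a k * b k‖ ≤ √(∑ k, ‖a k‖ ^ 2) * √(∑ k, ‖b k‖ ^ 2) := by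
  refine (norm_sum_le _ _).trans ?_
  simp only [norm_mul]
  exact Real.sum_mul_le_sqrt_mul_sqrt _ _ _

theorem sqrt_sum_norm_add_sq_le {ι : Type*} [Fintype ι] (a b : ι → ℂ) :
    √(∑ k, ‖a k + b k‖ ^ 2) ≤ √(∑ k, ‖a k‖ ^ 2) + √(∑ k, ‖b k‖ ^ 2) := by
  simpa [EuclideanSpace.norm_eq] using norm_add_le (WithLp.toLp 2 a) (WithLp.toLp 2 b)

theorem sqrt_sum_norm_mul_sq_le {ι : Type*} [Fintype ι] (a b : ι → ℂ) {C : ℝ} (hC : 0 ≤ C)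
    (h : ∀ k, ‖a k‖ ≤ C) :
    √(∑ k, ‖a k * b k‖ ^ 2) ≤ C * √(∑ k, ‖b k‖ ^ 2) := by
  rw [← Real.sqrt_sq hC, ← Real.sqrt_mul (sq_nonneg C), Finset.mul_sum]
  refine Real.sqrt_le_sqrt (Finset.sum_le_sum fun k _ => ?_)
  rw [norm_mul, mul_pow]
  gcongr
  exact h k

/-- The energy balance of an eigenvector `(x, y)` of the impurity matrix. -/
theorem re_eigenvalue_mul_energy {ι : Type*} [Fintype ι] {h : ℝ} {γ E : ι → ℝ} {v m y : ι → ℂ}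
    {x μ : ℂ}
    (hx : -(Complex.I * h) * x + ∑ k, (-Complex.I * v k - m k) * y k = μ * x)
    (hy : ∀ k, (-Complex.I * conj (v k) - conj (m k)) * x - (γ k + Complex.I * E k) * y k
      = μ * y k) :
    μ.re * (‖x‖ ^ 2 + ∑ k, ‖y k‖ ^ 2)
      = -(∑ k, γ k * ‖y k‖ ^ 2) - 2 * (conj x * ∑ k, m k * y k).re := by
  have key : μ * (‖x‖ ^ 2 + ∑ k, ‖y k‖ ^ 2 : ℝ)
      = conj x * (-(Complex.I * h) * x + ∑ k, (-Complex.I * v k - m k) * y k)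
        + ∑ k, conj (y k) * ((-Complex.I * conj (v k) - conj (m k)) * x
          - (γ k + Complex.I * E k) * y k) := by
    rw [hx]
    simp only [hy]
    push_cast
    rw [mul_add, Finset.mul_sum]
    congr 1
    · rw [← Complex.conj_mul']; ring
    · refine Finset.sum_congr rfl fun k _ => ?_
      rw [← Complex.conj_mul']; ring
  have hre := congrArg Complex.re key
  rw [Complex.re_mul_ofReal] at hre
  rw [hre]
  simp only [Complex.add_re, Complex.re_sum, mul_add, Finset.mul_sum, Complex.sq_norm,
    Complex.normSq_apply]
  rw [← Finset.sum_neg_distrib, add_assoc, ← Finset.sum_add_distrib, ← Finset.sum_sub_distrib]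
  have h0 : (conj x * (-(Complex.I * h) * x)).re = 0 := by
    simp; ring
  rw [h0, zero_add]
  refine Finset.sum_congr rfl fun k _ => ?_
  simp
  ring

/-- If an eigenvector has eigenvalue of nonnegative real part, its bath component is small. -/
theorem bath_le_of_re_nonneg {ι : Type*} [Fintype ι] {h g r : ℝ} {γ E : ι → ℝ} {v m y : ι → ℂ}
    {x μ : ℂ} (hg : 0 < g) (hgγ : ∀ k, g ≤ γ k) (hr : 2 * √(∑ k, ‖m k‖ ^ 2) = r * g)
    (hx : -(Complex.I * h) * x + ∑ k, (-Complex.I * v k - m k) * y k = μ * x)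
    (hy : ∀ k, (-Complex.I * conj (v k) - conj (m k)) * x - (γ k + Complex.I * E k) * y k
      = μ * y k) (hμ : 0 ≤ μ.re) :
    √(∑ k, ‖y k‖ ^ 2) ≤ r * ‖x‖ := by
  have hen := re_eigenvalue_mul_energy hx hy
  have hY : √(∑ k, ‖y k‖ ^ 2) ^ 2 = ∑ k, ‖y k‖ ^ 2 := Real.sq_sqrt (by positivity)
  have hl : 0 ≤ μ.re * (‖x‖ ^ 2 + ∑ k, ‖y k‖ ^ 2) := by positivity
  have hγy : g * ∑ k, ‖y k‖ ^ 2 ≤ ∑ k, γ k * ‖y k‖ ^ 2 := by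
    rw [Finset.mul_sum]
    exact Finset.sum_le_sum fun k _ => mul_le_mul_of_nonneg_right (hgγ k) (by positivity)
  have hm : -(conj x * ∑ k, m k * y k).re
      ≤ ‖x‖ * (√(∑ k, ‖m k‖ ^ 2) * √(∑ k, ‖y k‖ ^ 2)) := by
    refine (neg_le_abs _).trans ((Complex.abs_re_le_norm _).trans ?_)
    rw [norm_mul, Complex.norm_conj]
    gcongr
    exact norm_sum_mul_le_sqrt_mul_sqrt m y
  rw [← hY] at hγy
  have hr0 : 0 ≤ r := by
    refine nonneg_of_mul_nonneg_left (b := g) ?_ hg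
    rw [← hr]; positivity
  have hy0 : 0 ≤ √(∑ k, ‖y k‖ ^ 2) := Real.sqrt_nonneg _
  generalize √(∑ k, ‖y k‖ ^ 2) = Y at *
  generalize √(∑ k, ‖m k‖ ^ 2) = A at *
  by_contra! hlt
  have hYpos : 0 < Y := lt_of_le_of_lt (by positivity) hlt
  have h1 : g * Y ^ 2 ≤ r * g * ‖x‖ * Y := by rw [← hr]; nlinarith
  have h2 := mul_lt_mul_of_pos_left hlt (mul_pos hg hYpos)
  nlinarith

/-- If the bath component of an eigenvector is small relative to the impurity component, the
hybridisation is bounded. -/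
theorem hybridisation_mul_le {ι : Type*} [Fintype ι] {h r K : ℝ} {z v m y : ι → ℂ}
    {x μ : ℂ} (hr : 0 ≤ r) (hr1 : r ≤ 1) (hK0 : 0 ≤ K) (hK : ∀ k, ‖z k‖ ≤ K) (hx0 : x ≠ 0)
    (hx : -(Complex.I * h) * x + ∑ k, (-Complex.I * v k - m k) * y k = μ * x)
    (hy : ∀ k, (-Complex.I * conj (v k) - conj (m k)) * x - z k * y k = μ * y k)
    (hb : √(∑ k, ‖y k‖ ^ 2) ≤ r * ‖x‖) :
    √(∑ k, ‖v k‖ ^ 2) * (1 - r ^ 2) ≤ |h| + 2 * √(∑ k, ‖m k‖ ^ 2) + K := by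
  have hxpos : 0 < ‖x‖ := norm_pos_iff.mpr hx0
  have hμ : ‖μ‖ ≤ |h| + (√(∑ k, ‖v k‖ ^ 2) + √(∑ k, ‖m k‖ ^ 2)) * r := by
    refine le_of_mul_le_mul_right ?_ hxpos
    have hw := sqrt_sum_norm_add_sq_le (fun k => -Complex.I * v k) (fun k => -m k)
    simp only [← sub_eq_add_neg, norm_mul, norm_neg, Complex.norm_I, one_mul] at hw
    calc ‖μ‖ * ‖x‖ = ‖-(Complex.I * h) * x + ∑ k, (-Complex.I * v k - m k) * y k‖ := by
          rw [hx, norm_mul]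
      _ ≤ |h| * ‖x‖ + (√(∑ k, ‖v k‖ ^ 2) + √(∑ k, ‖m k‖ ^ 2)) * (r * ‖x‖) := by
          refine (norm_add_le _ _).trans (add_le_add (by simp) ?_)
          refine (norm_sum_mul_le_sqrt_mul_sqrt _ _).trans ?_
          gcongr
      _ = _ := by ring
  have hv : √(∑ k, ‖v k‖ ^ 2) ≤ √(∑ k, ‖m k‖ ^ 2) + (‖μ‖ + K) * r := by
    refine le_of_mul_le_mul_right ?_ hxpos
    have hV := sqrt_sum_norm_add_sq_le (fun k => (-x) * conj (m k)) (fun k => -((μ + z k) * y k))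
    have hVeq : ∀ k, -x * conj (m k) + -((μ + z k) * y k) = Complex.I * conj (v k) * x :=
      fun k => by linear_combination hy k
    have hVn : √(∑ k, ‖Complex.I * conj (v k) * x‖ ^ 2) = √(∑ k, ‖v k‖ ^ 2) * ‖x‖ := by
      simp only [norm_mul, Complex.norm_I, Complex.norm_conj, one_mul, mul_pow]
      rw [← Finset.sum_mul, Real.sqrt_mul (by positivity), Real.sqrt_sq hxpos.le]
    have hMn := sqrt_sum_norm_mul_sq_le (fun _ => -x) (fun k => conj (m k)) hxpos.le
      (fun k => (norm_neg x).le)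
    have hZn := sqrt_sum_norm_mul_sq_le (fun k => μ + z k) y (C := ‖μ‖ + K) (by positivity)
      (fun k => (norm_add_le _ _).trans (by gcongr; exact hK k))
    simp only [hVeq, hVn, norm_neg] at hV
    simp only [Complex.norm_conj] at hMn
    have hZn' : (‖μ‖ + K) * √(∑ k, ‖y k‖ ^ 2) ≤ (‖μ‖ + K) * (r * ‖x‖) := by gcongr
    linarith
  have hm0 : 0 ≤ √(∑ k, ‖m k‖ ^ 2) := Real.sqrt_nonneg _
  generalize √(∑ k, ‖m k‖ ^ 2) = A at *
  generalize √(∑ k, ‖v k‖ ^ 2) = B at *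
  have h1 := mul_le_mul_of_nonneg_right hμ hr
  have h2 : |h| * r ≤ |h| := mul_le_of_le_one_right (abs_nonneg h) hr1
  have h3 : K * r ≤ K := mul_le_of_le_one_right hK0 hr1
  have h4 : A * (r * r) ≤ A := mul_le_of_le_one_right hm0 (by nlinarith)
  nlinarith

/-- Stability of the single-site noninteracting fermionic impurity model.
Let `X = [[-ih, -iV - M], [-iVᴴ - Mᴴ, -Z]]` with `h ∈ ℝ`, `V, M` complex `1 × N` row
vectors, and `Z = diag(γₖ + i Eₖ)` with `γₖ > 0`. If `‖M‖ < (1/2) minₖ γₖ` (i.e.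
`‖M‖ < γₖ/2` for every `k`), then there exists `m > 0` such that whenever `‖V‖ > m`,
every eigenvalue of `X` has strictly negative real part. -/
theorem stmt_12 {N : ℕ} (h : ℝ) (γ E : Fin N → ℝ) (hγ : ∀ k, 0 < γ k)
    (M : Matrix (Fin 1) (Fin N) ℂ)
    (hM : ∀ k, Real.sqrt (∑ j, ‖M 0 j‖ ^ 2) < (1 / 2) * γ k) :
    ∃ m > (0 : ℝ), ∀ V : Matrix (Fin 1) (Fin N) ℂ,
      m < Real.sqrt (∑ j, ‖V 0 j‖ ^ 2) →
      ∀ μ ∈ spectrum ℂ (Matrix.fromBlocks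
          !![-(Complex.I * (h : ℂ))]
          ((-Complex.I) • V - M)
          ((-Complex.I) • Vᴴ - Mᴴ)
          (-(Matrix.diagonal fun k => ((γ k : ℂ) + Complex.I * (E k : ℂ))))),
        μ.re < 0 := by
  rcases isEmpty_or_nonempty (Fin N) with hN | hN
  · refine ⟨1, one_pos, fun V hV => ?_⟩
    simp at hV
    linarith
  obtain ⟨k₀, hk₀⟩ := Finite.exists_min γ
  have hg := hγ k₀
  set r := 2 * √(∑ j, ‖M 0 j‖ ^ 2) / γ k₀ with hrdef
  have hr : 2 * √(∑ j, ‖M 0 j‖ ^ 2) = r * γ k₀ := by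
    rw [hrdef]; field_simp
  have hr0 : 0 ≤ r := by positivity
  have hr1 : r < 1 := by
    rw [hrdef, div_lt_one hg]; linarith [hM k₀]
  have hr2 : 0 < 1 - r ^ 2 := by nlinarith
  set K := ∑ k, ‖(γ k : ℂ) + Complex.I * (E k : ℂ)‖ with hKdef
  have hK0 : 0 ≤ K := by positivity
  have hK : ∀ k, ‖(γ k : ℂ) + Complex.I * (E k : ℂ)‖ ≤ K := fun k =>
    Finset.single_le_sum (f := fun k => ‖(γ k : ℂ) + Complex.I * (E k : ℂ)‖)
      (fun _ _ => norm_nonneg _) (Finset.mem_univ k)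
  refine ⟨(|h| + 2 * √(∑ j, ‖M 0 j‖ ^ 2) + K + 1) / (1 - r ^ 2), by positivity,
    fun V hV μ hμ => ?_⟩
  rw [← Matrix.spectrum_toLin', ← Module.End.hasEigenvalue_iff_mem_spectrum] at hμ
  obtain ⟨u, hu⟩ := hμ.exists_hasEigenvector
  have hu0 := hu.2
  have hu1 := hu.apply_eq_smul
  rw [Matrix.toLin'_apply] at hu1
  have hx : -(Complex.I * h) * u (.inl 0) + ∑ k, (-Complex.I * V 0 k - M 0 k) * u (.inr k)
      = μ * u (.inl 0) := by
    simpa [Matrix.mulVec, dotProduct] using congrFun hu1 (.inl 0)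
  have hy : ∀ k, (-Complex.I * conj (V 0 k) - conj (M 0 k)) * u (.inl 0)
      - (γ k + Complex.I * E k) * u (.inr k) = μ * u (.inr k) := fun k => by
    have hk := congrFun hu1 (.inr k)
    simp [Matrix.mulVec, dotProduct, Matrix.diagonal_apply] at hk
    linear_combination hk
  by_contra! hre
  have hb := bath_le_of_re_nonneg hg hk₀ hr hx hy hre
  have hx0 : u (.inl 0) ≠ 0 := by
    intro hx0
    rw [hx0, norm_zero, mul_zero, Real.sqrt_le_iff] at hb
    have hs : ∑ k, ‖u (.inr k)‖ ^ 2 = 0 :=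
      le_antisymm (by simpa using hb.2) (by positivity)
    rw [Finset.sum_eq_zero_iff_of_nonneg (fun _ _ => by positivity)] at hs
    refine hu0 (funext fun i => ?_)
    rcases i with i | k
    · rw [Subsingleton.elim i 0, hx0]; rfl
    · simpa using hs k (Finset.mem_univ k)
  have hB := hybridisation_mul_le hr0 hr1.le hK0 hK hx0 hx hy hb
  rw [div_lt_iff₀ hr2] at hV
  linarith
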